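/- Let m ∈ ℕ, let X be an ℝ^m-system (not necessarily ergodic), and let V be a linear subspace of ℝ^m. Then either V ⊆ W(X), or there exists an at most countable family (V_j)_{j∈J} of proper linear subspaces of V such that W(X) ∩ V ⊆ ⋃_{j∈J} V_j. -/

import Mathlib

open MeasureTheory Filter Topology

structure RSystem (m : ℕ) (X : Type*) [MeasurableSpace X] (μ : Measure X) where
  T : (Fin m → ℝ) → X → X
  measurable_pair : Measurable fun p : (Fin m → ℝ) × X => T p.1 p.2
  measurePreserving : ∀ α, MeasurePreserving (T α) μ μ
  T_zero : T 0 = id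
  T_add : ∀ α β, T α ∘ T β = T (α + β)
  separableL2 : TopologicalSpace.SeparableSpace (Lp ℂ 2 μ)

namespace RSystem

variable {m : ℕ} {X : Type*} [MeasurableSpace X] {μ : Measure X}

/-- The system is ergodic. -/
def IsErgodic (S : RSystem m X μ) : Prop :=
  ∀ A : Set X, MeasurableSet A → (∀ α, μ (symmDiff (S.T α ⁻¹' A) A) = 0) →
    μ A = 0 ∨ μ A = 1

end RSystem

/-- A set of reals has density one. -/
def HasDensityOne (A : Set ℝ) : Prop :=
  Tendsto (fun T' : ℝ => (volume (A ∩ Set.Icc 0 T')).toReal / T') atTop (nhds 1)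

namespace RSystem

variable {m : ℕ} {X : Type*} [MeasurableSpace X] {μ : Measure X}

/-- `ν` is weakly equidistributed for the system. -/
def WeaklyEquidistributed (S : RSystem m X μ) (ν : Measure (Fin m → ℝ)) : Prop :=
  ∃ A : Set ℝ, MeasurableSet A ∧ HasDensityOne A ∧
    ∀ f : X → ℂ, Measurable f → (∃ C, ∀ x, ‖f x‖ ≤ C) →
      ∀ᵐ x ∂μ, Tendsto (fun t : ℝ => ∫ α, f (S.T (t • α) x) ∂ν)
        (atTop ⊓ Filter.principal A) (nhds (∫ x, f x ∂μ))

/-- The system is good for double Birkhoff averages. -/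
def GoodForDoubleBirkhoff (S : RSystem m X μ) : Prop :=
  ∀ (f₁ f₂ : X → ℂ), Measurable f₁ → Measurable f₂ →
    (∃ C, ∀ x, ‖f₁ x‖ ≤ C) → (∃ C, ∀ x, ‖f₂ x‖ ≤ C) →
    ∀ α₁ α₂ : Fin m → ℝ, ∀ᵐ x ∂μ, ∃ L : ℂ,
      Tendsto (fun T' : ℝ => (1 / T' : ℝ) •
          ∫ t in Set.Ioc (0:ℝ) T', f₁ (S.T (t • α₁) x) * f₂ (S.T (t • α₂) x))
        atTop (nhds L)

/-- The σ-algebra (collection of sets) invariant under `T_g`, `g ∈ H`, up to null sets. -/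
def InvSets (S : RSystem m X μ) (H : Set (Fin m → ℝ)) : Set (Set X) :=
  {A | MeasurableSet A ∧ ∀ g ∈ H, μ (symmDiff (S.T g ⁻¹' A) A) = 0}

/-- The set of non-ergodic directions. -/
def W (S : RSystem m X μ) : Set (Fin m → ℝ) :=
  {α | S.InvSets (Set.range fun t : ℝ => t • α) ≠ S.InvSets Set.univ}

end RSystem

/-- A hyperplane of `ℝ^m`: a translate of an `(m-1)`-dimensional linear subspace. -/
def IsHyperplane (m : ℕ) (ℓ : Set (Fin m → ℝ)) : Prop :=
  ∃ (V : Submodule ℝ (Fin m → ℝ)) (β : Fin m → ℝ),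
    Module.finrank ℝ V = m - 1 ∧ ℓ = (fun v => v + β) '' (V : Set (Fin m → ℝ))

/-- A family of pairwise orthogonal nonzero vectors in a separable inner product space is
countable. -/
theorem countable_of_pairwise_inner_eq_zero {𝕜 H ι : Type*} [RCLike 𝕜] [NormedAddCommGroup H]
    [InnerProductSpace 𝕜 H] [TopologicalSpace.SeparableSpace H] {f : ι → H}
    (hne : ∀ i, f i ≠ 0) (horth : Pairwise fun i j => inner 𝕜 (f i) (f j) = 0) :
    Countable ι := by
  refine Pairwise.countable_of_isOpen_disjoint (s := fun i => Metric.ball (f i) (‖f i‖ / 2))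
    (fun i j hij => ?_) (fun i => Metric.isOpen_ball)
    (fun i => ⟨f i, Metric.mem_ball_self (half_pos (norm_pos_iff.2 (hne i)))⟩)
  apply Metric.ball_disjoint_ball
  rw [dist_eq_norm]
  have h := norm_sub_sq (𝕜 := 𝕜) (f i) (f j)
  rw [horth hij, map_zero] at h
  have hi : ‖f i‖ ≤ ‖f i - f j‖ :=
    abs_le_of_sq_le_sq' (by nlinarith [sq_nonneg ‖f j‖]) (norm_nonneg _) |>.2
  have hj : ‖f j‖ ≤ ‖f i - f j‖ :=
    abs_le_of_sq_le_sq' (by nlinarith [sq_nonneg ‖f i‖]) (norm_nonneg _) |>.2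
  linarith

section FixedVectors

variable {𝕜 H G : Type*} [RCLike 𝕜] [NormedAddCommGroup H] [InnerProductSpace 𝕜 H]

/-- The vectors fixed by every operator `K g` with `g ∈ U`. -/
def fixedVectors (K : G → H →ₗᵢ[𝕜] H) (U : Set G) : Submodule 𝕜 H where
  carrier := {x | ∀ g ∈ U, K g x = x}
  add_mem' hx hy g hg := by rw [map_add, hx g hg, hy g hg]
  zero_mem' g _ := map_zero _
  smul_mem' c x hx g hg := by rw [map_smul, hx g hg]

theorem mem_fixedVectors {K : G → H →ₗᵢ[𝕜] H} {U : Set G} {x : H} :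
    x ∈ fixedVectors K U ↔ ∀ g ∈ U, K g x = x :=
  Iff.rfl

theorem fixedVectors_anti (K : G → H →ₗᵢ[𝕜] H) {U V : Set G} (h : U ⊆ V) :
    fixedVectors K V ≤ fixedVectors K U :=
  fun _ hx g hg => hx g (h hg)

theorem isClosed_fixedVectors (K : G → H →ₗᵢ[𝕜] H) (U : Set G) :
    IsClosed (fixedVectors K U : Set H) := by
  have : (fixedVectors K U : Set H) = ⋂ g ∈ U, {x | K g x = x} := by
    ext x
    simp [mem_fixedVectors]
  rw [this]
  exact isClosed_biInter fun g _ => isClosed_eq (K g).continuous continuous_id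

instance [CompleteSpace H] (K : G → H →ₗᵢ[𝕜] H) (U : Set G) :
    (fixedVectors K U).HasOrthogonalProjection :=
  have := (isClosed_fixedVectors K U).completeSpace_coe
  inferInstance

theorem exists_mem_fixedVectors_orthogonal [CompleteSpace H] (K : G → H →ₗᵢ[𝕜] H) {U V : Set G}
    (hUV : U ⊆ V)
    (h : ¬ fixedVectors K U ≤ fixedVectors K V) :
    ∃ x ∈ fixedVectors K U, x ≠ 0 ∧ x ∈ (fixedVectors K V)ᗮ := by
  obtain ⟨x, hxU, hxV⟩ := SetLike.not_le_iff_exists.1 h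
  have hP := Submodule.starProjection_apply_mem (fixedVectors K V) x
  refine ⟨x - (fixedVectors K V).starProjection x,
    sub_mem hxU (fixedVectors_anti K hUV hP), fun h0 => hxV ?_,
    Submodule.sub_starProjection_mem_orthogonal x⟩
  rwa [sub_eq_zero.1 h0]

variable [AddCommGroup G] {K : G → H →ₗᵢ[𝕜] H}

theorem map_mem_fixedVectors (hadd : ∀ a b x, K a (K b x) = K (a + b) x) {U : Set G} {x : H}
    (hx : x ∈ fixedVectors K U) (g : G) : K g x ∈ fixedVectors K U := fun u hu => by
  rw [hadd, add_comm, ← hadd, hx u hu]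

/-- The operators of a commutative group action by isometries commute with the projection onto
the vectors fixed by a subset of the group. -/
theorem starProjection_fixedVectors_map [CompleteSpace H] (hzero : ∀ x, K 0 x = x)
    (hadd : ∀ a b x, K a (K b x) = K (a + b) x) (U : Set G) (g : G) (x : H) :
    (fixedVectors K U).starProjection (K g x) = K g ((fixedVectors K U).starProjection x) := by
  refine Submodule.eq_starProjection_of_mem_of_inner_eq_zero
    (map_mem_fixedVectors hadd (Submodule.starProjection_apply_mem _ x) g) fun w hw => ?_
  have hw' : K g (K (-g) w) = w := by rw [hadd, add_neg_cancel, hzero]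
  rw [← hw', ← map_sub, LinearIsometry.inner_map_map]
  exact Submodule.starProjection_inner_eq_zero _ _ (map_mem_fixedVectors hadd hw (-g))

theorem starProjection_mem_fixedVectors [CompleteSpace H] (hzero : ∀ x, K 0 x = x)
    (hadd : ∀ a b x, K a (K b x) = K (a + b) x) (U : Set G) {V : Set G} {x : H}
    (hx : x ∈ fixedVectors K V) : (fixedVectors K U).starProjection x ∈ fixedVectors K V :=
  fun g hg => by rw [← starProjection_fixedVectors_map hzero hadd, hx g hg]

theorem inf_fixedVectors_le_sup {R : Type*} [Ring R] [Module R G]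
    (hadd : ∀ a b x, K a (K b x) = K (a + b) x) (U₁ U₂ : Submodule R G) :
    fixedVectors K (U₁ : Set G) ⊓ fixedVectors K (U₂ : Set G) ≤
      fixedVectors K ((U₁ ⊔ U₂ : Submodule R G) : Set G) := by
  rintro x ⟨h₁, h₂⟩ g hg
  obtain ⟨a, ha, b, hb, rfl⟩ := Submodule.mem_sup.1 hg
  rw [← hadd, h₂ b hb, h₁ a ha]

/-- If every vector fixed by both `U₁` and `U₂` is fixed by `V`, then vectors fixed by `U₁`, resp.
by `U₂`, are orthogonal to each other as soon as they are orthogonal to those fixed by `V`. -/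
theorem inner_eq_zero_of_inf_fixedVectors_le [CompleteSpace H] (hzero : ∀ x, K 0 x = x)
    (hadd : ∀ a b x, K a (K b x) = K (a + b) x) {U₁ U₂ V : Set G}
    (hV : fixedVectors K U₁ ⊓ fixedVectors K U₂ ≤ fixedVectors K V) {x y : H}
    (hx : x ∈ fixedVectors K U₁) (hy : y ∈ fixedVectors K U₂) (hyV : y ∈ (fixedVectors K V)ᗮ) :
    inner 𝕜 y x = 0 := by
  have hP : (fixedVectors K U₂).starProjection x ∈ fixedVectors K V :=
    hV ⟨starProjection_mem_fixedVectors hzero hadd U₂ hx, Submodule.starProjection_apply_mem _ x⟩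
  rw [← sub_add_cancel x ((fixedVectors K U₂).starProjection x), inner_add_right,
    (Submodule.mem_orthogonal _ _).1 (Submodule.sub_starProjection_mem_orthogonal x) y hy,
    (Submodule.mem_orthogonal' _ _).1 hyV _ hP, add_zero]

/-- The maximal proper subspaces of `V` that fix more vectors than `V` are countably many. -/
theorem countable_maximal_fixedVectors {R : Type*} [Ring R] [Module R G] [CompleteSpace H]
    [TopologicalSpace.SeparableSpace H] (hzero : ∀ x, K 0 x = x)
    (hadd : ∀ a b x, K a (K b x) = K (a + b) x) (V : Submodule R G) :
    Countable {U : Submodule R G // Maximal (fun U => U < V ∧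
      ¬ fixedVectors K (U : Set G) ≤ fixedVectors K (V : Set G)) U} := by
  choose f hf hf0 hfV using fun U : {U : Submodule R G // Maximal (fun U => U < V ∧
      ¬ fixedVectors K (U : Set G) ≤ fixedVectors K (V : Set G)) U} =>
    exists_mem_fixedVectors_orthogonal K (U := (U.1 : Set G)) (V := (V : Set G))
      (SetLike.coe_subset_coe.2 U.2.prop.1.le) U.2.prop.2
  refine countable_of_pairwise_inner_eq_zero (𝕜 := 𝕜) hf0 fun U₁ U₂ hne =>
    inner_eq_zero_of_inf_fixedVectors_le hzero hadd ?_ (hf U₂) (hf U₁) (hfV U₁)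
  refine (inf_fixedVectors_le_sup hadd _ _).trans ?_
  by_contra hsup
  have hlt : U₂.1 ⊔ U₁.1 < V := by
    refine lt_of_le_of_ne (sup_le U₂.2.prop.1.le U₁.2.prop.1.le) fun h => hsup ?_
    rw [h]
  exact hne (Subtype.ext ((U₁.2.eq_of_le ⟨hlt, hsup⟩ le_sup_right).trans
    (U₂.2.eq_of_le ⟨hlt, hsup⟩ le_sup_left).symm))

end FixedVectors

namespace RSystem

variable {m : ℕ} {X : Type*} [MeasurableSpace X] {μ : Measure X}

/-- The Koopman operators of the system on `L²`. -/
noncomputable def koopman (S : RSystem m X μ) (α : Fin m → ℝ) : Lp ℂ 2 μ →ₗᵢ[ℂ] Lp ℂ 2 μ :=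
  Lp.compMeasurePreservingₗᵢ ℂ (S.T α) (S.measurePreserving α)

theorem koopman_zero (S : RSystem m X μ) (f : Lp ℂ 2 μ) : S.koopman 0 f = f := by
  refine Lp.ext ((Lp.coeFn_compMeasurePreserving f (S.measurePreserving 0)).trans ?_)
  rw [S.T_zero, Function.comp_id]

theorem koopman_koopman (S : RSystem m X μ) (α β : Fin m → ℝ) (f : Lp ℂ 2 μ) :
    S.koopman α (S.koopman β f) = S.koopman (α + β) f := by
  refine Lp.ext ((Lp.coeFn_compMeasurePreserving _ (S.measurePreserving α)).trans ?_)
  refine ((S.measurePreserving α).quasiMeasurePreserving.ae_eq_comp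
    (Lp.coeFn_compMeasurePreserving f (S.measurePreserving β))).trans ?_
  refine EventuallyEq.trans ?_ (Lp.coeFn_compMeasurePreserving f
    (S.measurePreserving (α + β))).symm
  rw [Function.comp_assoc, S.T_add, add_comm]

theorem indicatorConstLp_mem_fixedVectors_koopman [IsFiniteMeasure μ] (S : RSystem m X μ)
    {A : Set X} (hA : MeasurableSet A) (H : Set (Fin m → ℝ)) :
    indicatorConstLp 2 hA (measure_ne_top μ A) (1 : ℂ) ∈ fixedVectors S.koopman H ↔
      A ∈ S.InvSets H := by
  refine Iff.trans (forall₂_congr fun g _ => ?_) (and_iff_right hA).symm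
  have hK : S.koopman g (indicatorConstLp 2 hA (measure_ne_top μ A) (1 : ℂ)) =
      indicatorConstLp 2 (hA.preimage (S.measurePreserving g).measurable)
        (measure_ne_top μ _) 1 := rfl
  rw [hK, measure_symmDiff_eq_zero_iff]
  exact indicatorConstLp_inj _ _ _ _ one_ne_zero

theorem invSets_anti (S : RSystem m X μ) {H₁ H₂ : Set (Fin m → ℝ)} (h : H₁ ⊆ H₂) :
    S.InvSets H₂ ⊆ S.InvSets H₁ :=
  fun _ hA => ⟨hA.1, fun g hg => hA.2 g (h hg)⟩

end RSystem

/-- For an `ℝ^m`-system and a linear subspace `V` of `ℝ^m`, either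
`V ⊆ W(X)`, or `W(X) ∩ V` is covered by an at most countable family of proper linear
subspaces of `V`. -/
theorem W_inter_subspace_dichotomy
    (m : ℕ) (X : Type) [MeasurableSpace X] (μ : Measure X) [IsProbabilityMeasure μ]
    (S : RSystem m X μ) (V : Submodule ℝ (Fin m → ℝ)) :
    (V : Set (Fin m → ℝ)) ⊆ S.W ∨
      ∃ 𝒱 : Set (Submodule ℝ (Fin m → ℝ)), 𝒱.Countable ∧ (∀ U ∈ 𝒱, U < V) ∧
        S.W ∩ (V : Set (Fin m → ℝ)) ⊆ ⋃ U ∈ 𝒱, (U : Set (Fin m → ℝ)) := by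
  have hrange : ∀ α : Fin m → ℝ,
      Set.range (fun t : ℝ => t • α) = (Submodule.span ℝ {α} : Set (Fin m → ℝ)) := fun α => by
    ext; simp [Submodule.mem_span_singleton]
  have hspan : ∀ α ∈ V, Submodule.span ℝ {α} ≤ V := fun α hα =>
    (Submodule.span_singleton_le_iff_mem α V).2 hα
  by_cases hV : S.InvSets V = S.InvSets Set.univ
  · have := S.separableL2
    refine Or.inr ⟨{U | Maximal (fun U => U < V ∧ ¬ fixedVectors S.koopman (U : Set (Fin m → ℝ)) ≤
      fixedVectors S.koopman (V : Set (Fin m → ℝ))) U},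
      Set.countable_coe_iff.1
        (countable_maximal_fixedVectors S.koopman_zero S.koopman_koopman V),
      fun U hU => (Set.mem_ofPred.1 hU).prop.1, ?_⟩
    rintro α ⟨hαW, hαV⟩
    have hα : S.InvSets (Submodule.span ℝ {α} : Set (Fin m → ℝ)) ≠ S.InvSets V := by
      rw [hV, ← hrange]
      exact hαW
    have hfix : ¬ fixedVectors S.koopman (Submodule.span ℝ {α} : Set (Fin m → ℝ)) ≤
        fixedVectors S.koopman (V : Set (Fin m → ℝ)) := fun hle =>
      hα (Set.Subset.antisymm
        (fun A hA => (S.indicatorConstLp_mem_fixedVectors_koopman hA.1 _).1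
          (hle ((S.indicatorConstLp_mem_fixedVectors_koopman hA.1 _).2 hA)))
        (S.invSets_anti (hspan α hαV)))
    have hlt : Submodule.span ℝ {α} < V :=
      lt_of_le_of_ne (hspan α hαV) fun h => hα (by rw [h])
    obtain ⟨U, hU, hmax⟩ := exists_maximal_ge_of_wellFoundedGT
      (fun U : Submodule ℝ (Fin m → ℝ) => U < V ∧
        ¬ fixedVectors S.koopman (U : Set (Fin m → ℝ)) ≤
          fixedVectors S.koopman (V : Set (Fin m → ℝ))) _ ⟨hlt, hfix⟩
    exact Set.mem_biUnion hmax (hU (Submodule.mem_span_singleton_self α))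
  · refine Or.inl fun α hα hαW => hV ?_
    rw [hrange] at hαW
    exact Set.Subset.antisymm ((S.invSets_anti (hspan α hα)).trans hαW.subset)
      (S.invSets_anti (Set.subset_univ _))
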